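/- Colour the vertices 0,…,2s+1 of the (2s+2)-gon alternately, odd vertices black and even vertices white. The map sending a quadrangulation D of the (2s+2)-gon to the collection of the unique black–black diagonals of its quadrilaterals is a bijection between quadrangulations of the (2s+2)-gon and noncrossing trees on the s+1 black vertices; its inverse sends a noncrossing tree to the set of all black–white edges that do not cross any edge of the tree. -/

import Mathlib

namespace FriezeNote

/-- `x` lies strictly between `a` and `b`, going in the positive direction
around the vertices `0, 1, …, m-1` of the `m`-gon. -/
def StrictBtw (m : ℕ) (a x b : ZMod m) : Prop :=
  0 < (x - a).val ∧ (x - a).val < (b - a).val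

/-- Two chords of the `m`-gon cross (in the interior of the polygon). -/
def Crosses (m : ℕ) (e f : Sym2 (ZMod m)) : Prop :=
  ∃ a b c d : ZMod m, e = s(a, b) ∧ f = s(c, d) ∧
    StrictBtw m a c b ∧ StrictBtw m b d a

/-- `e` is a diagonal of the `m`-gon: its endpoints are distinct and non-adjacent. -/
def IsDiagonal (m : ℕ) (e : Sym2 (ZMod m)) : Prop :=
  ∃ a b : ZMod m, e = s(a, b) ∧ a ≠ b ∧ b ≠ a + 1 ∧ a ≠ b + 1

/-- `e` is a boundary edge of the `m`-gon. -/
def IsPolyEdge (m : ℕ) (e : Sym2 (ZMod m)) : Prop :=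
  ∃ a : ZMod m, e = s(a, a + 1)

/-- A dissection of the `m`-gon: a set of pairwise non-crossing diagonals. -/
def IsDissection (m : ℕ) (D : Set (Sym2 (ZMod m))) : Prop :=
  (∀ e ∈ D, IsDiagonal m e) ∧ ∀ e ∈ D, ∀ f ∈ D, ¬ Crosses m e f

/-- `b` is the cyclic successor of `a` among the vertices of the finite set `C`:
both lie in `C` and no element of `C` lies strictly between them. -/
def CycConsec (m : ℕ) (C : Finset (ZMod m)) (a b : ZMod m) : Prop :=
  a ∈ C ∧ b ∈ C ∧ a ≠ b ∧ ∀ x ∈ C, ¬ StrictBtw m a x b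

/-- `C` is the vertex set of one of the subpolygons (cells) into which the
dissection `D` splits the `m`-gon: it has at least `3` vertices, cyclically
consecutive vertices of `C` are joined by a diagonal of `D` or a boundary edge,
and any diagonal of `D` with both endpoints in `C` joins cyclically consecutive
vertices of `C`. -/
def IsCell (m : ℕ) (D : Set (Sym2 (ZMod m))) (C : Finset (ZMod m)) : Prop :=
  3 ≤ C.card ∧
  (∀ a b : ZMod m, CycConsec m C a b → (s(a, b) ∈ D ∨ IsPolyEdge m s(a, b))) ∧
  (∀ a b : ZMod m, a ∈ C → b ∈ C → s(a, b) ∈ D →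
    (CycConsec m C a b ∨ CycConsec m C b a))

/-- `D` is a `p`-angulation of the `m`-gon: a dissection all of whose
subpolygons are `p`-gons. -/
def IsPAngulation (m p : ℕ) (D : Set (Sym2 (ZMod m))) : Prop :=
  IsDissection m D ∧ ∀ C : Finset (ZMod m), IsCell m D C → C.card = p

/-- The number of subpolygons of the dissection `D` incident with the vertex `α`. -/
noncomputable def cellCount (m : ℕ) (D : Set (Sym2 (ZMod m))) (α : ZMod m) : ℕ :=
  {C : Finset (ZMod m) | IsCell m D C ∧ α ∈ C}.ncard

/-- A frieze pattern of width `n`: rows numbered `0, …, n + 3` from below (entries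
of rows beyond `n + 3` are irrelevant), each row indexed by `ℤ`, rows `0` and
`n + 3` are zeroes, rows `1` and `n + 2` are ones, rows `2` through `n + 1` are
positive, and every diamond `b` (top), `a` (left), `d` (right), `c` (bottom)
satisfies `a * d - b * c = 1`. -/
structure Frieze (n : ℕ) where
  entry : ℕ → ℤ → ℝ
  nonneg : ∀ i k, i ≤ n + 3 → 0 ≤ entry i k
  row_zero : ∀ k, entry 0 k = 0
  row_top : ∀ k, entry (n + 3) k = 0
  row_one : ∀ k, entry 1 k = 1
  row_penult : ∀ k, entry (n + 2) k = 1
  row_pos : ∀ i k, 2 ≤ i → i ≤ n + 1 → 0 < entry i k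
  diamond : ∀ i k, 1 ≤ i → i ≤ n + 2 →
    entry i k * entry i (k + 1) - entry (i + 1) k * entry (i - 1) (k + 1) = 1

/-- `λ_p = 2 cos (π / p)`. -/
noncomputable def lambda (p : ℕ) : ℝ := 2 * Real.cos (Real.pi / p)

/-- A frieze pattern is of type `Λ_p` if every entry of its quiddity row (row `2`)
is a positive integral multiple of `λ_p`. -/
def IsTypeLambda (p : ℕ) {n : ℕ} (F : Frieze n) : Prop :=
  ∀ k : ℤ, ∃ q : ℕ, 0 < q ∧ F.entry 2 k = (q : ℝ) * lambda p

/-- `F` is the frieze of type `Λ_p` associated to the `p`-angulation `D` of the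
`m`-gon: its quiddity row is the periodic sequence `(λ_p q_0, …, λ_p q_{m-1})`. -/
def FriezeOfPAng (p m : ℕ) {n : ℕ} (F : Frieze n) (D : Set (Sym2 (ZMod m))) : Prop :=
  ∀ k : ℤ, F.entry 2 k = lambda p * (cellCount m D (k : ZMod m) : ℝ)

/-- `F` is the Conway–Coxeter frieze of the triangulation `T` of the `m`-gon:
its quiddity row is the periodic sequence `(t_0, …, t_{m-1})` where `t_α` is the
number of triangles of `T` incident with the vertex `α`. -/
def CCFrieze (m : ℕ) {n : ℕ} (F : Frieze n) (T : Set (Sym2 (ZMod m))) : Prop :=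
  ∀ k : ℤ, F.entry 2 k = (cellCount m T (k : ZMod m) : ℝ)

/-- A vertex of the `m`-gon is black when its label is odd (vertices are coloured
alternately, odd vertices black and even vertices white). -/
def IsBlack (m : ℕ) (a : ZMod m) : Prop := a.val % 2 = 1

/-- The set of chords joining two distinct black (odd) vertices of a common
subpolygon of the dissection `D`. -/
def oddPairs (m : ℕ) (D : Set (Sym2 (ZMod m))) : Set (Sym2 (ZMod m)) :=
  {e | ∃ (C : Finset (ZMod m)) (a b : ZMod m),
    IsCell m D C ∧ e = s(a, b) ∧ a ∈ C ∧ b ∈ C ∧ a ≠ b ∧ IsBlack m a ∧ IsBlack m b}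

/-- The triangulation associated to a dissection `D`: the diagonals of `D`
together with, inside each subpolygon, the chords joining pairs of its odd
(black) vertices. -/
def assocTriangulation (m : ℕ) (D : Set (Sym2 (ZMod m))) : Set (Sym2 (ZMod m)) :=
  D ∪ oddPairs m D

/-- `E` is a noncrossing tree on the black (odd) vertices of the `m`-gon:
its edges join distinct black vertices, are pairwise non-crossing, any two black
vertices are connected by a sequence of edges, and there is no loop of edges. -/
def IsNoncrossingTree (m : ℕ) (E : Set (Sym2 (ZMod m))) : Prop :=
  (∀ e ∈ E, ∃ a b : ZMod m, e = s(a, b) ∧ a ≠ b ∧ IsBlack m a ∧ IsBlack m b) ∧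
  (∀ e ∈ E, ∀ f ∈ E, ¬ Crosses m e f) ∧
  (∀ a b : ZMod m, IsBlack m a → IsBlack m b →
    (SimpleGraph.fromEdgeSet E).Reachable a b) ∧
  (SimpleGraph.fromEdgeSet E).IsAcyclic

/-- The inverse of the tree-of-quadrangulation map: it sends a noncrossing tree
`E` to the set of all black–white diagonals crossing no edge of `E`. -/
def quadOfTree (m : ℕ) (E : Set (Sym2 (ZMod m))) : Set (Sym2 (ZMod m)) :=
  {e | IsDiagonal m e ∧
    (∃ a b : ZMod m, e = s(a, b) ∧ IsBlack m a ∧ ¬ IsBlack m b) ∧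
    ∀ f ∈ E, ¬ Crosses m e f}

/-- `e` is a diagonal of the subpolygon with vertex set `C`: both endpoints are
distinct vertices of `C` which are not cyclically consecutive in `C`. -/
def CellDiagonal (m : ℕ) (C : Finset (ZMod m)) (e : Sym2 (ZMod m)) : Prop :=
  ∃ a b : ZMod m, e = s(a, b) ∧ a ∈ C ∧ b ∈ C ∧ a ≠ b ∧
    ¬ CycConsec m C a b ∧ ¬ CycConsec m C b a

/-- `e` is an edge of the subpolygon with vertex set `C`: it joins two
cyclically consecutive vertices of `C`. -/
def CellEdge (m : ℕ) (C : Finset (ZMod m)) (e : Sym2 (ZMod m)) : Prop :=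
  ∃ a b : ZMod m, e = s(a, b) ∧ (CycConsec m C a b ∨ CycConsec m C b a)

/-- `C` is an ear of the dissection `D`: a subpolygon all of whose edges except
exactly one are boundary edges of the polygon. -/
def IsEar (m : ℕ) (D : Set (Sym2 (ZMod m))) (C : Finset (ZMod m)) : Prop :=
  IsCell m D C ∧ ∃! e : Sym2 (ZMod m), CellEdge m C e ∧ ¬ IsPolyEdge m e

/-- The dual graph of a dissection `D`: vertices are the subpolygons of `D`, and
two subpolygons are adjacent when they share a common edge (a diagonal of `D`). -/
def dualGraph (m : ℕ) (D : Set (Sym2 (ZMod m))) :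
    SimpleGraph {C : Finset (ZMod m) // IsCell m D C} :=
  SimpleGraph.fromRel fun C C' =>
    ∃ e ∈ D, ∃ a b : ZMod m, e = s(a, b) ∧
      a ∈ C.1 ∧ b ∈ C.1 ∧ a ∈ C'.1 ∧ b ∈ C'.1

structure QS (m : ℕ) (Ch : ℕ → ℕ → Prop) : Prop where
  lt : ∀ a b, Ch a b → a < b ∧ b < m
  edge : ∀ a, a + 1 < m → Ch a (a + 1)
  top : Ch 0 (m - 1)
  nc : ∀ a b c d, Ch a b → Ch c d → ¬ (a < c ∧ c < b ∧ b < d)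
  split : ∀ a b, Ch a b → a + 2 ≤ b →
    ∃ x y, a < x ∧ x < y ∧ y < b ∧ Ch a x ∧ Ch x y ∧ Ch y b

def Quad (Ch : ℕ → ℕ → Prop) (a x y b : ℕ) : Prop :=
  a < x ∧ x < y ∧ y < b ∧ Ch a b ∧ Ch a x ∧ Ch x y ∧ Ch y b

def TQ (Ch : ℕ → ℕ → Prop) (u v : ℕ) : Prop :=
  ∃ a x y b, Quad Ch a x y b ∧
    ((u = a ∧ v = y ∧ a % 2 = 1) ∨ (u = x ∧ v = b ∧ x % 2 = 1))

structure NT (m : ℕ) (T : ℕ → ℕ → Prop) : Prop where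
  lt : ∀ u v, T u v → u < v ∧ v < m ∧ u % 2 = 1 ∧ v % 2 = 1
  nc : ∀ a b c d, T a b → T c d → ¬ (a < c ∧ c < b ∧ b < d)
  conn : ∀ S : ℕ → Prop, (∀ u v, T u v → (S u ↔ S v)) →
    ∀ u v, u < m → v < m → u % 2 = 1 → v % 2 = 1 → S u → S v
  bridge : ∀ p q, T p q → ∃ S : ℕ → Prop, S p ∧ ¬ S q ∧
    ∀ u v, T u v → ¬ (u = p ∧ v = q) → (S u ↔ S v)

def ChT (m : ℕ) (T : ℕ → ℕ → Prop) (a b : ℕ) : Prop :=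
  a < b ∧ b < m ∧ (a + b) % 2 = 1 ∧
    ∀ u v, T u v → ¬ (a < u ∧ u < b ∧ b < v) ∧ ¬ (u < a ∧ a < v ∧ v < b)

theorem QS.parity {m Ch} (h : QS m Ch) : ∀ n a b, b - a ≤ n → Ch a b → (a + b) % 2 = 1 := by
  intro n
  induction n with
  | zero => intro a b hn hc; have := h.lt a b hc; omega
  | succ n ih =>
    intro a b hn hc
    have h1 := h.lt a b hc
    by_cases hb : b = a + 1
    · omega
    · obtain ⟨x, y, h2, h3, h4, c1, c2, c3⟩ := h.split a b hc (by omega)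
      have := ih a x (by omega) c1
      have := ih x y (by omega) c2
      have := ih y b (by omega) c3
      omega

theorem QS.par {m Ch} (h : QS m Ch) {a b} (hc : Ch a b) : (a + b) % 2 = 1 :=
  h.parity _ a b le_rfl hc

/-- A chord noncrossing with a quad, lying within it. -/
theorem QS.loc {m Ch} (h : QS m Ch) {a x y b} (q : Quad Ch a x y b) {c d}
    (hcd : c < d) (hp : (c + d) % 2 = 1) (hac : a ≤ c) (hdb : d ≤ b)
    (hn : ∀ e f, Ch e f → ¬ (e < c ∧ c < f ∧ f < d) ∧ ¬ (c < e ∧ e < d ∧ d < f)) :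
    (c = a ∧ d = b) ∨ d ≤ x ∨ (x ≤ c ∧ d ≤ y) ∨ y ≤ c := by
  obtain ⟨h1, h2, h3, c0, c1, c2, c3⟩ := q
  have := hn _ _ c1
  have := hn _ _ c2
  have := hn _ _ c3
  have := h.par c0
  have := h.par c1
  have := h.par c2
  have := h.par c3
  omega

theorem QS.ncc {m Ch} (h : QS m Ch) {c d} (hc : Ch c d) :
    ∀ e f, Ch e f → ¬ (e < c ∧ c < f ∧ f < d) ∧ ¬ (c < e ∧ e < d ∧ d < f) :=
  fun _ _ hef => ⟨h.nc _ _ _ _ hef hc, h.nc _ _ _ _ hc hef⟩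

theorem QS.uniq_aux {m Ch} (h : QS m Ch) {a x y b x' y'} (q : Quad Ch a x y b)
    (q' : Quad Ch a x' y' b) : x' ≤ x := by
  obtain ⟨k1, k2, k3, d0, d1, d2, d3⟩ := q'
  have := h.loc q k1 (h.par d1) le_rfl (by omega) (h.ncc d1)
  obtain ⟨h1, h2, h3, c0, c1, c2, c3⟩ := q
  omega

theorem QS.uniq_aux2 {m Ch} (h : QS m Ch) {a x y b y'} (q : Quad Ch a x y b)
    (q' : Quad Ch a x y' b) : y' ≤ y := by
  obtain ⟨k1, k2, k3, d0, d1, d2, d3⟩ := q'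
  have := h.loc q k2 (h.par d2) (by omega) (by omega) (h.ncc d2)
  obtain ⟨h1, h2, h3, c0, c1, c2, c3⟩ := q
  omega

theorem QS.uniq {m Ch} (h : QS m Ch) {a x y b x' y'} (q : Quad Ch a x y b)
    (q' : Quad Ch a x' y' b) : x = x' ∧ y = y' := by
  obtain rfl : x = x' := le_antisymm (h.uniq_aux q' q) (h.uniq_aux q q')
  exact ⟨rfl, le_antisymm (h.uniq_aux2 q' q) (h.uniq_aux2 q q')⟩

theorem QS.pos {m Ch} (h : QS m Ch) {a x y b a' x' y' b'} (q : Quad Ch a x y b)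
    (q' : Quad Ch a' x' y' b') :
    (a = a' ∧ b = b' ∧ x = x' ∧ y = y') ∨ b' ≤ a ∨ b ≤ a' ∨
    (a ≤ a' ∧ b' ≤ x) ∨ (x ≤ a' ∧ b' ≤ y) ∨ (y ≤ a' ∧ b' ≤ b) ∨
    (a' ≤ a ∧ b ≤ x') ∨ (x' ≤ a ∧ b ≤ y') ∨ (y' ≤ a ∧ b ≤ b') := by
  have l := h.lt _ _ q.2.2.2.1
  have l' := h.lt _ _ q'.2.2.2.1
  have n := h.ncc q.2.2.2.1 _ _ q'.2.2.2.1
  by_cases e : a = a' ∧ b = b'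
  · obtain ⟨rfl, rfl⟩ := e
    have := h.uniq q q'
    omega
  by_cases i : a ≤ a' ∧ b' ≤ b
  · have := h.loc q l'.1 (h.par q'.2.2.2.1) i.1 i.2 (h.ncc q'.2.2.2.1)
    omega
  by_cases i : a' ≤ a ∧ b ≤ b'
  · have := h.loc q' l.1 (h.par q.2.2.2.1) i.1 i.2 (h.ncc q.2.2.2.1)
    omega
  omega

theorem QS.exq {m Ch} (h : QS m Ch) {a b} (c : Ch a b) (hab : a + 2 ≤ b) :
    ∃ x y, Quad Ch a x y b := by
  obtain ⟨x, y, h1, h2, h3, c1, c2, c3⟩ := h.split a b c hab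
  exact ⟨x, y, h1, h2, h3, c, c1, c2, c3⟩

theorem QS.conn {m Ch} (h : QS m Ch) (S : ℕ → Prop) (hS : ∀ u v, TQ Ch u v → (S u ↔ S v)) :
    ∀ n a b, b - a ≤ n → Ch a b → ∀ u v, a ≤ u → u ≤ b → a ≤ v → v ≤ b →
      u % 2 = 1 → v % 2 = 1 → (S u ↔ S v) := by
  intro n
  induction n with
  | zero => intro a b hn hc; have := h.lt a b hc; omega
  | succ n ih =>
    intro a b hn hc
    have h1 := h.lt a b hc
    have hp := h.par hc
    by_cases hb : b = a + 1
    · intro u v _ _ _ _ _ _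
      have : u = v := by omega
      rw [this]
    · obtain ⟨x, y, q⟩ := h.exq hc (by omega)
      have q' := q
      obtain ⟨h2, h3, h4, c0, c1, c2, c3⟩ := q'
      have p1 := h.par c1
      have p2 := h.par c2
      have p3 := h.par c3
      have i1 := ih a x (by omega) c1
      have i2 := ih x y (by omega) c2
      have i3 := ih y b (by omega) c3
      have key : ∃ w, ∀ u, a ≤ u → u ≤ b → u % 2 = 1 → (S u ↔ S w) := by
        by_cases ha : a % 2 = 1
        · have t := hS a y ⟨a, x, y, b, q, Or.inl ⟨rfl, rfl, ha⟩⟩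
          refine ⟨y, fun u hu1 hu2 hu3 => ?_⟩
          by_cases k1 : u ≤ x
          · rw [← t]; exact i1 u a (by omega) (by omega) (by omega) (by omega) hu3 ha
          by_cases k2 : u ≤ y
          · exact i2 u y (by omega) (by omega) (by omega) (by omega) hu3 (by omega)
          · exact i3 u y (by omega) (by omega) (by omega) (by omega) hu3 (by omega)
        · have t := hS x b ⟨a, x, y, b, q, Or.inr ⟨rfl, rfl, by omega⟩⟩
          refine ⟨x, fun u hu1 hu2 hu3 => ?_⟩
          by_cases k1 : u ≤ x
          · exact i1 u x (by omega) (by omega) (by omega) (by omega) hu3 (by omega)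
          by_cases k2 : u ≤ y
          · exact i2 u x (by omega) (by omega) (by omega) (by omega) hu3 (by omega)
          · rw [t]; exact i3 u b (by omega) (by omega) (by omega) (by omega) hu3 (by omega)
      obtain ⟨w, hw⟩ := key
      intro u v a1 a2 a3 a4 a5 a6
      rw [hw u a1 a2 a5, hw v a3 a4 a6]

theorem QS.tree {m Ch} (h : QS m Ch) : NT m (TQ Ch) where
  lt := by
    rintro u v ⟨a, x, y, b, q, hq⟩
    have := h.lt _ _ q.2.2.2.1
    have := h.par q.2.2.2.1
    obtain ⟨h2, h3, h4, c0, c1, c2, c3⟩ := q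
    have p1 := h.par c1
    have p2 := h.par c2
    have p3 := h.par c3
    omega
  nc := by
    rintro u v u' v' ⟨a, x, y, b, q, hq⟩ ⟨a', x', y', b', q', hq'⟩
    have := h.pos q q'
    obtain ⟨h2, h3, h4, c0, c1, c2, c3⟩ := q
    obtain ⟨k2, k3, k4, d0, d1, d2, d3⟩ := q'
    have := h.par c1
    omega
  conn := by
    intro S hS u v hu hv h1 h2 h3
    exact (h.conn S hS _ 0 (m-1) le_rfl h.top u v (by omega) (by omega) (by omega) (by omega)
      h1 h2).1 h3
  bridge := by
    rintro p q ⟨a, x, y, b, Q, hq⟩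
    obtain ⟨h2, h3, h4, c0, c1, c2, c3⟩ := id Q
    have p1 := h.par c1
    have p2 := h.par c2
    have p3 := h.par c3
    rcases hq with ⟨rfl, rfl, ha⟩ | ⟨rfl, rfl, hx⟩
    · refine ⟨fun v => ¬ (x < v ∧ v < b), by omega, by omega, ?_⟩
      rintro u v ⟨a', x', y', b', Q', hq'⟩ hne
      have hpos := h.pos Q Q'
      obtain ⟨k2, k3, k4, d0, d1, d2, d3⟩ := id Q'
      have := h.par d1
      have := h.par d2
      have := h.par d3
      clear Q Q' c0 c1 c2 c3 d0 d1 d2 d3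
      rcases hpos with ⟨rfl, rfl, rfl, rfl⟩ | i | i | i | i | i | i | i | i <;>
      rcases hq' with ⟨rfl, rfl, hz⟩ | ⟨rfl, rfl, hz⟩ <;> omega
    · refine ⟨fun v => (a < v ∧ v < y), by omega, by omega, ?_⟩
      rintro u v ⟨a', x', y', b', Q', hq'⟩ hne
      have hpos := h.pos Q Q'
      obtain ⟨k2, k3, k4, d0, d1, d2, d3⟩ := id Q'
      have := h.par d1
      have := h.par d2
      have := h.par d3
      clear Q Q' c0 c1 c2 c3 d0 d1 d2 d3
      rcases hpos with ⟨rfl, rfl, rfl, rfl⟩ | i | i | i | i | i | i | i | i <;>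
      rcases hq' with ⟨rfl, rfl, hz⟩ | ⟨rfl, rfl, hz⟩ <;> omega

theorem NT.nc2 {m T} (h : NT m T) {a b c d} (h1 : T a b) (h2 : T c d) :
    ¬ (a < c ∧ c < b ∧ b < d) ∧ ¬ (c < a ∧ a < d ∧ d < b) :=
  ⟨h.nc _ _ _ _ h1 h2, h.nc _ _ _ _ h2 h1⟩

theorem NT.chnc {m T} (hm : m % 2 = 0) (h : NT m T) : ∀ a b c d, ChT m T a b → ChT m T c d →
    ¬ (a < c ∧ c < b ∧ b < d) := by
  rintro a b c d ⟨h1, h2, h3, h4⟩ ⟨k1, k2, k3, k4⟩ ⟨l1, l2, l3⟩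
  by_cases pa : a % 2 = 1 <;> by_cases pc : c % 2 = 1
  · refine absurd (h.conn (fun v => b < v ∧ v < d) ?_ (b+1) a (by omega) (by omega) (by omega)
      (by omega) (by omega)) (by omega)
    intro u v t
    have := h4 _ _ t
    have := k4 _ _ t
    have := h.lt _ _ t
    omega
  · refine absurd (h.conn (fun v => c < v ∧ v < b) ?_ (c+1) a (by omega) (by omega) (by omega)
      (by omega) (by omega)) (by omega)
    intro u v t
    have := h4 _ _ t
    have := k4 _ _ t
    have := h.lt _ _ t
    omega
  · refine absurd (h.conn (fun v => d < v ∨ v < a) ?_ (d+1) b (by omega) (by omega) (by omega)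
      (by omega) (by omega)) (by omega)
    intro u v t
    have := h4 _ _ t
    have := k4 _ _ t
    have := h.lt _ _ t
    omega
  · refine absurd (h.conn (fun v => a < v ∧ v < c) ?_ (a+1) b (by omega) (by omega) (by omega)
      (by omega) (by omega)) (by omega)
    intro u v t
    have := h4 _ _ t
    have := k4 _ _ t
    have := h.lt _ _ t
    omega

theorem exMax (P : ℕ → Prop) (B : ℕ) (a : ℕ) (ha : P a) (hB : ∀ n, P n → n ≤ B) :
    ∃ u, P u ∧ ∀ v, P v → v ≤ u := by
  by_contra hc
  push Not at hc
  have : ∀ k, ∃ n, P n ∧ k ≤ n := by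
    intro k
    induction k with
    | zero => exact ⟨a, ha, by omega⟩
    | succ k ih =>
      obtain ⟨n, h1, h2⟩ := ih
      obtain ⟨n', h3, h4⟩ := hc n h1
      exact ⟨n', h3, by omega⟩
  obtain ⟨n, h1, h2⟩ := this (B+1)
  have := hB n h1
  omega

theorem exMin (P : ℕ → Prop) (a : ℕ) (ha : P a) :
    ∃ u, P u ∧ ∀ v, P v → u ≤ v := by
  classical
  exact ⟨Nat.find ⟨a, ha⟩, Nat.find_spec ⟨a, ha⟩, fun v hv => Nat.find_min' _ hv⟩

theorem NT.mid {m T} (h : NT m T) {p q} (t : T p q) :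
    ∃ w, p < w ∧ w < q ∧ ChT m T p w ∧ ChT m T w q := by
  obtain ⟨S, sp, sq, hS⟩ := h.bridge p q t
  have l := h.lt _ _ t
  obtain ⟨u, ⟨u1, u2, u3, u4⟩, hu⟩ := exMax (fun u => S u ∧ p ≤ u ∧ u ≤ q ∧ u % 2 = 1) q p
    ⟨sp, by omega, by omega, by omega⟩ (by rintro n ⟨_, _, h, _⟩; exact h)
  have uq : u ≠ q := by rintro rfl; exact sq u1
  have key : ∀ c d, T c d → p ≤ c → c ≤ u → u < d → d ≤ q → (c = p ∧ d = q) ∨ c = u := by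
    intro c d tcd h1 h2 h3 h4
    by_contra hne
    push Not at hne
    have lc := h.lt _ _ tcd
    have iff := hS c d tcd (by omega)
    have nd : ¬ S d := fun sd => by
      have := hu d ⟨sd, by omega, by omega, by omega⟩
      omega
    have nc : ¬ S c := by rwa [iff]
    have hcu : c < u := by omega
    have hpc : p ≠ c := by rintro rfl; exact nc sp
    refine absurd (h.conn (fun v => S v ∧ c < v ∧ v < d) ?_ u p (by omega) (by omega) (by omega)
      (by omega) ⟨u1, by omega, by omega⟩) (by omega)
    intro v w tvw
    have n1 := h.nc2 tcd tvw
    have n2 := h.lt _ _ tvw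
    by_cases e : v = p ∧ w = q
    · omega
    have i := hS v w tvw e
    constructor
    · rintro ⟨a1, a2, a3⟩
      have b1 := i.1 a1
      refine ⟨b1, ?_⟩
      have : w ≠ d := by rintro rfl; exact nd b1
      have : w ≠ c := by rintro rfl; exact nc b1
      omega
    · rintro ⟨a1, a2, a3⟩
      have b1 := i.2 a1
      refine ⟨b1, ?_⟩
      have : v ≠ d := by rintro rfl; exact nd b1
      have : v ≠ c := by rintro rfl; exact nc b1
      omega
  have keyu : ∀ d, T u d → u < d → d ≤ q → (u = p ∧ d = q) := by
    intro d t1 h1 h2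
    by_contra hne
    have := (hS u d t1 hne).1 u1
    have lc := h.lt _ _ t1
    have := hu d ⟨this, by omega, by omega, by omega⟩
    omega
  have key2 : ∀ c d, T c d → p ≤ c → c ≤ u → u < d → d ≤ q → (c = p ∧ d = q) := by
    intro c d tcd h1 h2 h3 h4
    rcases key c d tcd h1 h2 h3 h4 with e | rfl
    · exact e
    · exact keyu d tcd h3 h4
  refine ⟨u + 1, by omega, by omega, ⟨by omega, by omega, by omega, ?_⟩,
    ⟨by omega, by omega, by omega, ?_⟩⟩
  · intro c d tcd
    have n := h.nc2 t tcd
    have lc := h.lt _ _ tcd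
    refine ⟨fun hh => ?_, fun hh => by omega⟩
    have := key2 c d tcd (by omega) (by omega) (by omega) (by omega)
    omega
  · intro c d tcd
    have n := h.nc2 t tcd
    have lc := h.lt _ _ tcd
    refine ⟨fun hh => by omega, fun hh => ?_⟩
    have := key2 c d tcd (by omega) (by omega) (by omega) (by omega)
    omega

theorem NT.splitT {m T} (h : NT m T) {a b} (c : ChT m T a b) (hab : a + 2 ≤ b) :
    ∃ x y, a < x ∧ x < y ∧ y < b ∧ ChT m T a x ∧ ChT m T x y ∧ ChT m T y b ∧
      (if a % 2 = 1 then T a y else T x b) := by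
  obtain ⟨h1, h2, h3, h4⟩ := id c
  by_cases ha : a % 2 = 1
  · simp only [ha, if_true]
    have ex : ∃ y, T a y ∧ y < b := by
      by_contra hne
      push Not at hne
      refine absurd (h.conn (fun v => a < v ∧ v < b) ?_ (b-1) a (by omega) (by omega) (by omega)
        (by omega) (by omega)) (by omega)
      intro u v t
      have := h4 _ _ t
      have := h.lt _ _ t
      have : u = a → b ≤ v := by rintro rfl; exact hne v t
      omega
    obtain ⟨y0, hy0⟩ := ex
    obtain ⟨y, ⟨t, hy⟩, hmax⟩ := exMax (fun y => T a y ∧ y < b) b y0 hy0 (fun n hn => by omega)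
    obtain ⟨x, hx1, hx2, c1, c2⟩ := h.mid t
    refine ⟨x, y, hx1, hx2, hy, c1, c2, ⟨hy, h2, ?_, ?_⟩, t⟩
    · have := h.lt _ _ t; omega
    intro u v tt
    have := h4 _ _ tt
    have := h.nc2 t tt
    have := h.lt _ _ tt
    have : u = a → v < b → v ≤ y := by rintro rfl hv; exact hmax v ⟨tt, hv⟩
    omega
  · simp only [ha, if_false]
    have ex : ∃ x, T x b ∧ a < x := by
      by_contra hne
      push Not at hne
      refine absurd (h.conn (fun v => a < v ∧ v < b) ?_ (a+1) b (by omega) (by omega) (by omega)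
        (by omega) (by omega)) (by omega)
      intro u v t
      have := h4 _ _ t
      have := h.lt _ _ t
      have : v = b → u ≤ a := by rintro rfl; exact hne u t
      omega
    obtain ⟨y0, hy0⟩ := ex
    obtain ⟨x, ⟨t, hx⟩, hmin⟩ := exMin (fun x => T x b ∧ a < x) y0 hy0
    obtain ⟨y, hx1, hx2, c1, c2⟩ := h.mid t
    have lt := h.lt _ _ t
    refine ⟨x, y, hx, hx1, hx2, ⟨hx, by omega, by omega, ?_⟩, c1, c2, t⟩
    intro u v tt
    have := h4 _ _ tt
    have := h.nc2 t tt
    have := h.lt _ _ tt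
    have : v = b → a < u → x ≤ u := by rintro rfl hv; exact hmin u ⟨tt, hv⟩
    omega

theorem NT.qs {m T} (hm : m % 2 = 0) (hm0 : 2 ≤ m) (h : NT m T) : QS m (ChT m T) where
  lt := fun a b hc => ⟨hc.1, hc.2.1⟩
  edge := fun a ha => ⟨by omega, ha, by omega, fun u v _ => by omega⟩
  top := ⟨by omega, by omega, by omega, fun u v t => by have := h.lt _ _ t; omega⟩
  nc := h.chnc hm
  split := fun a b c hab => by
    obtain ⟨x, y, h1, h2, h3, h4, h5, h6, _⟩ := h.splitT c hab
    exact ⟨x, y, h1, h2, h3, h4, h5, h6⟩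

theorem NT.tq {m T} (hm : m % 2 = 0) (hm0 : 2 ≤ m) (h : NT m T) (u v : ℕ) :
    TQ (ChT m T) u v ↔ T u v := by
  have hq := h.qs hm hm0
  have sub : ∀ u v, TQ (ChT m T) u v → T u v := by
    rintro u v ⟨a, x, y, b, q, hh⟩
    obtain ⟨l1, l2, l3, c0, c1, c2, c3⟩ := id q
    obtain ⟨x', y', h1, h2, h3, h4, h5, h6, t⟩ := h.splitT c0 (by omega)
    obtain ⟨rfl, rfl⟩ := hq.uniq q ⟨h1, h2, h3, c0, h4, h5, h6⟩
    have := hq.par c1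
    rcases hh with ⟨rfl, rfl, e⟩ | ⟨rfl, rfl, e⟩
    · simpa [e] using t
    · have : ¬ a % 2 = 1 := by omega
      simpa [this] using t
  refine ⟨sub u v, fun t => ?_⟩
  by_contra hn
  obtain ⟨S, s1, s2, hS⟩ := h.bridge u v t
  have l := h.lt _ _ t
  refine s2 (hq.tree.conn S ?_ u v (by omega) (by omega) (by omega) (by omega) s1)
  intro p q tt
  refine hS p q (sub _ _ tt) ?_
  rintro ⟨rfl, rfl⟩
  exact hn tt

theorem QS.cht {m Ch} (h : QS m Ch) (c d : ℕ) : ChT m (TQ Ch) c d ↔ Ch c d := by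
  have hd : ∀ c d, Ch c d → ChT m (TQ Ch) c d := by
    intro c d hc
    have l := h.lt _ _ hc
    refine ⟨l.1, l.2, h.par hc, ?_⟩
    rintro u v ⟨a, x, y, b, q, hh⟩
    obtain ⟨l1, l2, l3, c0, c1, c2, c3⟩ := id q
    have n0 := h.ncc hc _ _ c0
    have p1 := h.par c1
    have p2 := h.par c2
    have p3 := h.par c3
    have p := h.par hc
    have hloc := h.loc q l.1 (h.par hc)
    by_cases i : a ≤ c ∧ d ≤ b
    · replace hloc := hloc i.1 i.2 (h.ncc hc)
      clear n0
      rcases hh with ⟨rfl, rfl, hz⟩ | ⟨rfl, rfl, hz⟩ <;>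
      rcases hloc with i | i | i | i <;> omega
    · clear hloc p p1 p2 p3
      rcases hh with ⟨rfl, rfl, hz⟩ | ⟨rfl, rfl, hz⟩ <;> omega
  refine ⟨?_, hd c d⟩
  intro hc
  have h4 := hc.2.2.2
  obtain ⟨l1, l2, par, -⟩ := id hc
  have hm : m % 2 = 0 := by have := h.par h.top; omega
  have hn : ∀ e f, Ch e f → ¬ (e < c ∧ c < f ∧ f < d) ∧ ¬ (c < e ∧ e < d ∧ d < f) :=
    fun e f hef => ⟨h.tree.chnc hm _ _ _ _ (hd _ _ hef) hc, h.tree.chnc hm _ _ _ _ hc (hd _ _ hef)⟩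
  have main : ∀ n a b, b - a ≤ n → Ch a b → a ≤ c → d ≤ b → Ch c d := by
    intro n
    induction n with
    | zero => intro a b hn hc; have := h.lt a b hc; omega
    | succ n ih =>
      intro a b hnn hab ac db
      by_cases e : c = a ∧ d = b
      · obtain ⟨rfl, rfl⟩ := e; exact hab
      obtain ⟨x, y, q⟩ := h.exq hab (by omega)
      obtain ⟨k1, k2, k3, c0, c1, c2, c3⟩ := id q
      rcases h.loc q l1 par ac db hn with i | i | i | i
      · exact absurd i e
      · exact ih a x (by omega) c1 ac i
      · exact ih x y (by omega) c2 i.1 i.2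
      · exact ih y b (by omega) c3 i db
  exact main _ 0 (m-1) le_rfl h.top (by omega) (by omega)

theorem val_sub' {m : ℕ} [NeZero m] (x a : ZMod m) :
    (x - a).val = if a.val ≤ x.val then x.val - a.val else m + x.val - a.val := by
  have h1 := ZMod.val_lt x
  have h2 := ZMod.val_lt a
  split_ifs with h
  · exact ZMod.val_sub h
  · have e : x - a = ((m + x.val - a.val : ℕ) : ZMod m) := by
      rw [Nat.cast_sub (by omega)]
      simp
    rw [e, ZMod.val_natCast, Nat.mod_eq_of_lt (by omega)]

theorem sb_iff {m : ℕ} [NeZero m] (a x b : ZMod m) : StrictBtw m a x b ↔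
    (a.val < x.val ∧ x.val < b.val) ∨ (b.val < a.val ∧ (a.val < x.val ∨ x.val < b.val)) := by
  unfold StrictBtw
  have h1 := ZMod.val_lt x
  have h2 := ZMod.val_lt a
  have h3 := ZMod.val_lt b
  rw [val_sub', val_sub']
  split_ifs <;> omega

theorem crosses_iff {m : ℕ} [NeZero m] (a b c d : ZMod m) (hab : a.val < b.val)
    (hcd : c.val < d.val) : Crosses m s(a, b) s(c, d) ↔
    (a.val < c.val ∧ c.val < b.val ∧ b.val < d.val) ∨
    (c.val < a.val ∧ a.val < d.val ∧ d.val < b.val) := by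
  constructor
  · rintro ⟨a', b', c', d', h1, h2, h3, h4⟩
    rw [sb_iff] at h3 h4
    rw [Sym2.eq_iff] at h1 h2
    rcases h1 with ⟨rfl, rfl⟩ | ⟨rfl, rfl⟩ <;> rcases h2 with ⟨rfl, rfl⟩ | ⟨rfl, rfl⟩ <;> omega
  · rintro (h | h)
    · exact ⟨a, b, c, d, rfl, rfl, by rw [sb_iff]; omega, by rw [sb_iff]; omega⟩
    · exact ⟨a, b, d, c, rfl, Sym2.eq_swap, by rw [sb_iff]; omega, by rw [sb_iff]; omega⟩

theorem val_succ {m : ℕ} [NeZero m] (hm : 3 ≤ m) (a : ZMod m) :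
    (a + 1).val = if a.val + 1 < m then a.val + 1 else 0 := by
  have h1 := ZMod.val_lt a
  have h2 : (1 : ZMod m).val = 1 := by
    have := ZMod.val_natCast m 1
    rw [Nat.mod_eq_of_lt (by omega)] at this
    simpa using this
  rw [ZMod.val_add, h2]
  split_ifs with h
  · exact Nat.mod_eq_of_lt h
  · have : a.val + 1 = m := by omega
    rw [this, Nat.mod_self]

theorem val_ext {m : ℕ} [NeZero m] {a b : ZMod m} : a = b ↔ a.val = b.val :=
  ⟨fun h => by rw [h], fun h => ZMod.val_injective m h⟩

theorem poly_iff {m : ℕ} [NeZero m] (hm : 3 ≤ m) (a b : ZMod m) (hab : a.val < b.val) :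
    IsPolyEdge m s(a, b) ↔ b.val = a.val + 1 ∨ (a.val = 0 ∧ b.val + 1 = m) := by
  have ha := ZMod.val_lt a
  have hb := ZMod.val_lt b
  constructor
  · rintro ⟨c, hc⟩
    have h1 := val_succ hm c
    rw [Sym2.eq_iff] at hc
    rcases hc with ⟨rfl, rfl⟩ | ⟨rfl, rfl⟩ <;> split_ifs at h1 <;> omega
  · rintro (h | h)
    · refine ⟨a, ?_⟩
      have : b = a + 1 := by rw [val_ext, val_succ hm]; split_ifs <;> omega
      rw [this]
    · refine ⟨b, ?_⟩
      have : a = b + 1 := by rw [val_ext, val_succ hm]; split_ifs <;> omega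
      rw [← this]; exact Sym2.eq_swap

theorem diag_iff {m : ℕ} [NeZero m] (hm : 3 ≤ m) (a b : ZMod m) (hab : a.val < b.val) :
    IsDiagonal m s(a, b) ↔ ¬ (b.val = a.val + 1 ∨ (a.val = 0 ∧ b.val + 1 = m)) := by
  have ha := ZMod.val_lt a
  have hb := ZMod.val_lt b
  have key : (a ≠ b ∧ b ≠ a + 1 ∧ a ≠ b + 1) ↔
      ¬ (b.val = a.val + 1 ∨ (a.val = 0 ∧ b.val + 1 = m)) := by
    simp only [ne_eq, val_ext, val_succ hm]
    split_ifs <;> omega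
  rw [← key]
  constructor
  · rintro ⟨c, d, hc, h⟩
    rw [Sym2.eq_iff] at hc
    rcases hc with ⟨rfl, rfl⟩ | ⟨rfl, rfl⟩
    · exact h
    · exact ⟨h.1.symm, h.2.2, h.2.1⟩
  · intro h; exact ⟨a, b, rfl, h⟩

theorem diag_form {m : ℕ} [NeZero m] {e : Sym2 (ZMod m)} (h : ∃ a b, e = s(a, b) ∧ a ≠ b) :
    ∃ a b : ZMod m, e = s(a, b) ∧ a.val < b.val := by
  obtain ⟨a, b, rfl, h⟩ := h
  rw [Ne, val_ext] at h
  rcases Nat.lt_or_gt_of_ne h with h | h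
  · exact ⟨a, b, rfl, h⟩
  · exact ⟨b, a, Sym2.eq_swap, h⟩

def ChD (m : ℕ) (D : Set (Sym2 (ZMod m))) (a b : ℕ) : Prop :=
  a < b ∧ b < m ∧ (s((a : ZMod m), (b : ZMod m)) ∈ D ∨ b = a + 1 ∨ (a = 0 ∧ b + 1 = m))

theorem chd_val {m : ℕ} [NeZero m] (D : Set (Sym2 (ZMod m))) (a b : ZMod m)
    (h : a.val < b.val) : ChD m D a.val b.val ↔
      (s(a, b) ∈ D ∨ b.val = a.val + 1 ∨ (a.val = 0 ∧ b.val + 1 = m)) := by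
  have hb := ZMod.val_lt b
  simp [ChD, h, hb]

theorem val_cast {m : ℕ} {a : ℕ} (h : a < m) : ((a : ZMod m)).val = a := by
  rw [ZMod.val_natCast, Nat.mod_eq_of_lt h]

/-- consecutive in linear coordinates -/
def Cons (m : ℕ) (C : Finset (ZMod m)) (a b : ZMod m) : Prop :=
  (∀ x ∈ C, ¬ (a.val < x.val ∧ x.val < b.val)) ∨ (∀ x ∈ C, a.val ≤ x.val ∧ x.val ≤ b.val)

theorem cons_iff {m : ℕ} [NeZero m] (C : Finset (ZMod m)) (a b : ZMod m) (ha : a ∈ C) (hb : b ∈ C)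
    (h : a.val < b.val) : Cons m C a b ↔ (CycConsec m C a b ∨ CycConsec m C b a) := by
  have hne : a ≠ b := by rw [Ne, val_ext]; omega
  unfold Cons CycConsec
  simp only [ha, hb, hne, hne.symm, sb_iff, ne_eq, not_false_eq_true, true_and]
  refine or_congr (forall₂_congr fun x _ => ?_) (forall₂_congr fun x _ => ?_) <;> omega

theorem cell_iff {m : ℕ} [NeZero m] (hm : 3 ≤ m) (D : Set (Sym2 (ZMod m)))
    (hD : ∀ e ∈ D, IsDiagonal m e) (C : Finset (ZMod m)) :
    IsCell m D C ↔ 3 ≤ C.card ∧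
      (∀ a b, a ∈ C → b ∈ C → a.val < b.val → (Cons m C a b ↔ ChD m D a.val b.val)) := by
  unfold IsCell
  refine and_congr Iff.rfl ?_
  constructor
  · rintro ⟨h1, h2⟩ a b ha hb hab
    rw [cons_iff C a b ha hb hab, chd_val D a b hab]
    constructor
    · rintro (h | h)
      · have := h1 a b h
        rwa [poly_iff hm a b hab] at this
      · have := h1 b a h
        rwa [Sym2.eq_swap, poly_iff hm a b hab] at this
    · rintro (h | h)
      · exact h2 a b ha hb h
      · rw [← cons_iff C a b ha hb hab]
        rcases h with h | h
        · exact Or.inl fun x hx => by omega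
        · exact Or.inr fun x hx => by have := ZMod.val_lt x; omega
  · intro H
    constructor
    · intro a b hc
      obtain ⟨ha, hb, hne, -⟩ := id hc
      rw [Ne, val_ext] at hne
      rcases Nat.lt_or_gt_of_ne hne with h | h
      · rw [poly_iff hm a b h, ← chd_val D a b h, ← H a b ha hb h, cons_iff C a b ha hb h]
        exact Or.inl hc
      · rw [Sym2.eq_swap, poly_iff hm b a h, ← chd_val D b a h, ← H b a hb ha h,
          cons_iff C b a hb ha h]
        exact Or.inr hc
    · intro a b ha hb hab
      have hne : a ≠ b := by
        obtain ⟨c, d, hc, h, -⟩ := hD _ hab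
        rw [Sym2.eq_iff] at hc
        rcases hc with ⟨rfl, rfl⟩ | ⟨rfl, rfl⟩
        · exact h
        · exact h.symm
      rw [Ne, val_ext] at hne
      rcases Nat.lt_or_gt_of_ne hne with h | h
      · rw [← cons_iff C a b ha hb h, H a b ha hb h, chd_val D a b h]
        exact Or.inl hab
      · rw [or_comm, ← cons_iff C b a hb ha h, H b a hb ha h, chd_val D b a h, Sym2.eq_swap]
        exact Or.inl hab

theorem chd_nc {m : ℕ} [NeZero m] (D : Set (Sym2 (ZMod m)))
    (hD : IsDissection m D) : ∀ a b c d, ChD m D a b → ChD m D c d →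
      ¬ (a < c ∧ c < b ∧ b < d) := by
  rintro a b c d ⟨h1, h2, h3⟩ ⟨k1, k2, k3⟩ hh
  rcases h3 with h3 | h3
  · rcases k3 with k3 | k3
    · have := hD.2 _ h3 _ k3
      rw [crosses_iff _ _ _ _ (by rw [val_cast, val_cast] <;> omega)
        (by rw [val_cast, val_cast] <;> omega)] at this
      rw [val_cast, val_cast, val_cast, val_cast] at this <;> omega
    · omega
  · omega

theorem diss_of_qs {m : ℕ} [NeZero m] (D : Set (Sym2 (ZMod m)))
    (hD : ∀ e ∈ D, IsDiagonal m e) (h : QS m (ChD m D)) : IsDissection m D := by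
  refine ⟨hD, fun e he f hf => ?_⟩
  have he' := hD e he
  have hf' := hD f hf
  obtain ⟨a, b, rfl, hab⟩ := diag_form (e := e) (by
    obtain ⟨a, b, h1, h2, _⟩ := he'; exact ⟨a, b, h1, h2⟩)
  obtain ⟨c, d, rfl, hcd⟩ := diag_form (e := f) (by
    obtain ⟨a, b, h1, h2, _⟩ := hf'; exact ⟨a, b, h1, h2⟩)
  rw [crosses_iff _ _ _ _ hab hcd]
  have := h.nc _ _ _ _ ((chd_val D a b hab).2 (Or.inl he)) ((chd_val D c d hcd).2 (Or.inl hf))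
  have := h.nc _ _ _ _ ((chd_val D c d hcd).2 (Or.inl hf)) ((chd_val D a b hab).2 (Or.inl he))
  omega

theorem quad_card {m : ℕ} [NeZero m] {a x y b : ℕ} (h1 : a < x) (h2 : x < y) (h3 : y < b)
    (h4 : b < m) : ({(a : ZMod m), (x : ZMod m), (y : ZMod m), (b : ZMod m)} :
      Finset (ZMod m)).card = 4 := by
  have e : ∀ p q : ℕ, p < q → q < m → (p : ZMod m) ≠ (q : ZMod m) := by
    intro p q hpq hq
    rw [Ne, val_ext, val_cast hq, val_cast (by omega)]; omega
  rw [Finset.card_insert_of_notMem, Finset.card_insert_of_notMem, Finset.card_pair]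
  · exact e _ _ h3 h4
  · simp only [Finset.mem_insert, Finset.mem_singleton, not_or]
    exact ⟨e _ _ h2 (by omega), e _ _ (by omega) (by omega)⟩
  · simp only [Finset.mem_insert, Finset.mem_singleton, not_or]
    exact ⟨e _ _ h1 (by omega), e _ _ (by omega) (by omega), e _ _ (by omega) (by omega)⟩

theorem mem_quad {m : ℕ} [NeZero m] {a x y b : ℕ} (h1 : a < x) (h2 : x < y) (h3 : y < b)
    (h4 : b < m) (z : ZMod m) : z ∈ ({(a : ZMod m), (x : ZMod m), (y : ZMod m), (b : ZMod m)} :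
      Finset (ZMod m)) ↔ z.val = a ∨ z.val = x ∨ z.val = y ∨ z.val = b := by
  simp only [Finset.mem_insert, Finset.mem_singleton]
  simp only [val_ext]
  rw [val_cast h4, val_cast (by omega : y < m), val_cast (by omega : x < m),
    val_cast (by omega : a < m)]

theorem quad_cell {m : ℕ} [NeZero m] (hm : 3 ≤ m) (D : Set (Sym2 (ZMod m)))
    (hD : ∀ e ∈ D, IsDiagonal m e) (h : QS m (ChD m D)) {a x y b : ℕ}
    (q : Quad (ChD m D) a x y b) :
    IsCell m D {(a : ZMod m), (x : ZMod m), (y : ZMod m), (b : ZMod m)} := by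
  obtain ⟨h1, h2, h3, c0, c1, c2, c3⟩ := id q
  have hb := (h.lt _ _ c0).2
  rw [cell_iff hm D hD, quad_card h1 h2 h3 hb]
  refine ⟨by omega, ?_⟩
  intro p r hp hr hpr
  unfold Cons
  have mem := fun z => mem_quad (m := m) h1 h2 h3 hb z
  have ma := (mem a).2 (by rw [val_cast] <;> omega)
  have mx := (mem x).2 (by rw [val_cast] <;> omega)
  have my := (mem y).2 (by rw [val_cast] <;> omega)
  have mb := (mem b).2 (by rw [val_cast] <;> omega)
  have va : ((a : ZMod m)).val = a := val_cast (by omega)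
  have vx : ((x : ZMod m)).val = x := val_cast (by omega)
  have vy : ((y : ZMod m)).val = y := val_cast (by omega)
  have vb : ((b : ZMod m)).val = b := val_cast (by omega)
  rw [mem] at hp hr
  have p1 := h.par c1
  have p2 := h.par c2
  have p3 := h.par c3
  have pairs : (p.val = a ∧ r.val = b) ∨ (p.val = a ∧ r.val = x) ∨
      (p.val = x ∧ r.val = y) ∨ (p.val = y ∧ r.val = b) ∨ (p.val = a ∧ r.val = y) ∨
      (p.val = x ∧ r.val = b) := by
    clear ma mx my mb va vx vy vb p1 p2 p3 mem
    rcases hp with e | e | e | e <;> rcases hr with f | f | f | f <;> omega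
  have nay : ¬ ChD m D a y := fun hc => by have := h.par hc; omega
  have nxb : ¬ ChD m D x b := fun hc => by have := h.par hc; omega
  clear hp hr hpr p1 p2 p3
  rcases pairs with ⟨e, f⟩ | ⟨e, f⟩ | ⟨e, f⟩ | ⟨e, f⟩ | ⟨e, f⟩ | ⟨e, f⟩ <;> rw [e, f]
  · simp only [c0, iff_true]
    right
    intro z hz
    rw [mem] at hz
    omega
  · simp only [c1, iff_true]
    left
    intro z hz
    rw [mem] at hz
    omega
  · simp only [c2, iff_true]
    left
    intro z hz
    rw [mem] at hz
    omega
  · simp only [c3, iff_true]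
    left
    intro z hz
    rw [mem] at hz
    omega
  · simp only [nay, iff_false]
    rintro (hc | hc)
    · have := hc _ mx; omega
    · have := hc _ mb; omega
  · simp only [nxb, iff_false]
    rintro (hc | hc)
    · have := hc _ my; omega
    · have := hc _ ma; omega

theorem cell_quad {m : ℕ} [NeZero m] (hm : 3 ≤ m) (D : Set (Sym2 (ZMod m)))
    (hD : ∀ e ∈ D, IsDiagonal m e) (h : QS m (ChD m D)) (C : Finset (ZMod m))
    (hC : IsCell m D C) : ∃ a x y b, Quad (ChD m D) a x y b ∧
      C = {(a : ZMod m), (x : ZMod m), (y : ZMod m), (b : ZMod m)} := by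
  rw [cell_iff hm D hD] at hC
  obtain ⟨hcard, H⟩ := hC
  have hne : C.Nonempty := by rw [← Finset.card_pos]; omega
  obtain ⟨A, hA, hmin⟩ := C.exists_min_image ZMod.val hne
  obtain ⟨B, hB, hmax⟩ := C.exists_max_image ZMod.val hne
  obtain ⟨Z, hZ, hZA, hZB⟩ : ∃ Z ∈ C, Z ≠ A ∧ Z ≠ B := by
    by_contra hc
    push Not at hc
    have : C ⊆ {A, B} := by
      intro z hz
      have := hc z hz
      simp only [Finset.mem_insert, Finset.mem_singleton]
      tauto
    have := Finset.card_le_card this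
    have := Finset.card_le_two (a := A) (b := B)
    omega
  rw [Ne, val_ext] at hZA hZB
  have z1 := hmin Z hZ
  have z2 := hmax Z hZ
  have hAB : ChD m D A.val B.val := (H A B hA hB (by omega)).1 (Or.inr fun x hx => ⟨hmin x hx, hmax x hx⟩)
  -- predecessor and successor
  have gap : ∀ p, A.val < p → p < B.val → (∀ z ∈ C, z.val ≠ p) →
      ∃ u ∈ C, ∃ v ∈ C, u.val < p ∧ p < v.val ∧ ChD m D u.val v.val ∧
        ∀ z ∈ C, z.val ≤ u.val ∨ v.val ≤ z.val := by
    intro p hp1 hp2 hp3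
    obtain ⟨u, hu, hu2⟩ := (C.filter (fun z => z.val < p)).exists_max_image ZMod.val
      ⟨A, by simp [hA, hp1]⟩
    obtain ⟨v, hv, hv2⟩ := (C.filter (fun z => p < z.val)).exists_min_image ZMod.val
      ⟨B, by simp [hB, hp2]⟩
    simp only [Finset.mem_filter] at hu hv hu2 hv2
    have cl : ∀ z ∈ C, z.val ≤ u.val ∨ v.val ≤ z.val := by
      intro z hz
      rcases Nat.lt_or_gt_of_ne (hp3 z hz) with i | i
      · exact Or.inl (hu2 z ⟨hz, i⟩)
      · exact Or.inr (hv2 z ⟨hz, i⟩)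
    refine ⟨u, hu.1, v, hv.1, hu.2, hv.2, ?_, cl⟩
    refine (H u v hu.1 hv.1 (by omega)).1 (Or.inl ?_)
    intro z hz
    have := cl z hz
    omega
  have nocov : ∀ p q, ChD m D p q → A.val ≤ p → q ≤ B.val → ¬ (p = A.val ∧ q = B.val) →
      ∀ z ∈ C, ¬ (p < z.val ∧ z.val < q) := by
    rintro p q hpq h1 h2 h3 z hz ⟨h4, h5⟩
    have zA := hmin z hz
    have zB := hmax z hz
    by_cases hp : ∀ w ∈ C, w.val ≠ p
    · have : p ≠ A.val := fun e => hp A hA e.symm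
      obtain ⟨u, hu, v, hv, k1, k2, k3, k4⟩ := gap p (by omega) (by omega) hp
      have := k4 z hz
      have := h.nc _ _ _ _ k3 hpq
      omega
    by_cases hq : ∀ w ∈ C, w.val ≠ q
    · have : q ≠ B.val := fun e => hq B hB e.symm
      obtain ⟨u, hu, v, hv, k1, k2, k3, k4⟩ := gap q (by omega) (by omega) hq
      have := k4 z hz
      have := h.nc _ _ _ _ hpq k3
      omega
    push Not at hp hq
    obtain ⟨P, hP, rfl⟩ := hp
    obtain ⟨Q, hQ, rfl⟩ := hq
    rcases (H P Q hP hQ (by omega)).2 hpq with i | i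
    · exact i z hz ⟨h4, h5⟩
    · have := i A hA
      have := i B hB
      omega
  obtain ⟨x, y, q⟩ := h.exq hAB (by omega)
  obtain ⟨k1, k2, k3, c0, c1, c2, c3⟩ := id q
  refine ⟨A.val, x, y, B.val, q, ?_⟩
  have inC : ∀ w, w = x ∨ w = y → ∃ z ∈ C, z.val = w := by
    intro w hw
    by_contra hcon
    push Not at hcon
    obtain ⟨u, hu, v, hv, l1, l2, l3, l4⟩ := gap w (by omega) (by omega) hcon
    have := h.loc q (by omega) (h.par l3) (hmin u hu) (hmax v hv) (h.ncc l3)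
    have := l4 Z hZ
    omega
  ext z
  rw [mem_quad k1 k2 k3 (ZMod.val_lt B)]
  constructor
  · intro hz
    have := hmin z hz
    have := hmax z hz
    have := nocov _ _ c1 (by omega) (by omega) (by omega) z hz
    have := nocov _ _ c2 (by omega) (by omega) (by omega) z hz
    have := nocov _ _ c3 (by omega) (by omega) (by omega) z hz
    omega
  · rintro (e | e | e | e)
    · rw [← val_ext] at e; rwa [e]
    · obtain ⟨w, hw, hw2⟩ := inC x (Or.inl rfl)
      rw [← hw2, ← val_ext] at e; rwa [e]
    · obtain ⟨w, hw, hw2⟩ := inC y (Or.inr rfl)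
      rw [← hw2, ← val_ext] at e; rwa [e]
    · rw [← val_ext] at e; rwa [e]

theorem pang_of_qs {m : ℕ} [NeZero m] (hm : 3 ≤ m) (D : Set (Sym2 (ZMod m)))
    (hD : ∀ e ∈ D, IsDiagonal m e) (h : QS m (ChD m D)) : IsPAngulation m 4 D := by
  refine ⟨diss_of_qs D hD h, fun C hC => ?_⟩
  obtain ⟨a, x, y, b, q, rfl⟩ := cell_quad hm D hD h C hC
  exact quad_card q.1 q.2.1 q.2.2.1 (h.lt _ _ q.2.2.2.1).2

theorem qs_of_pang {m : ℕ} [NeZero m] (hm : 3 ≤ m) (D : Set (Sym2 (ZMod m)))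
    (h : IsPAngulation m 4 D) : QS m (ChD m D) := by
  classical
  have nc := chd_nc D h.1
  refine ⟨fun a b hc => ⟨hc.1, hc.2.1⟩, fun a ha => ⟨by omega, ha, by omega⟩,
    ⟨by omega, by omega, by omega⟩, nc, ?_⟩
  intro a b hab hab2
  have hbm := hab.2.1
  have edge : ∀ a, a + 1 < m → ChD m D a (a + 1) := fun a ha => ⟨by omega, ha, by omega⟩
  set P : ℕ → Prop := fun z => a ≤ z ∧ z ≤ b ∧
    ∀ c d, ChD m D c d → a ≤ c → d ≤ b → ¬ (c = a ∧ d = b) → ¬ (c < z ∧ z < d) with hP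
  have Pa : P a := ⟨by omega, by omega, fun c d _ _ _ _ => by omega⟩
  have Pb : P b := ⟨by omega, by omega, fun c d _ _ _ _ => by omega⟩
  have step : ∀ z, P z → z < b → ∃ w, P w ∧ z < w ∧ ChD m D z w ∧ ¬ (z = a ∧ w = b) ∧
      ∀ t, P t → t ≤ z ∨ w ≤ t := by
    intro z hz hzb
    obtain ⟨w, ⟨w1, w2, w3⟩, hw⟩ := exMax (fun d => ChD m D z d ∧ d ≤ b ∧ ¬ (z = a ∧ d = b)) b
      (z + 1) ⟨edge z (by omega), by omega, by omega⟩ (fun n hn => hn.2.1)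
    have zw := w1.1
    refine ⟨w, ⟨by have := hz.1; omega, w2, ?_⟩, w1.1, w1, w3, ?_⟩
    · rintro c d hcd h1 h2 h3 ⟨h4, h5⟩
      have n1 := nc _ _ _ _ w1 hcd
      have n2 := hz.2.2 c d hcd h1 h2 h3
      have : c = z := by omega
      subst this
      have := hw d ⟨hcd, h2, h3⟩
      omega
    · intro t ht
      have := ht.2.2 z w w1 hz.1 w2 w3
      omega
  set C : Finset (ZMod m) := Finset.univ.filter (fun z => P z.val) with hC
  have mem : ∀ z : ZMod m, z ∈ C ↔ P z.val := by intro z; simp [hC]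
  have memc : ∀ n, P n → (n : ZMod m) ∈ C := by
    intro n hn
    rw [mem, val_cast (by have := hn.2.1; omega)]; exact hn
  obtain ⟨x, Px, ax, cax, nax, gx⟩ := step a Pa (by omega)
  have xb : x < b := by have := Px.2.1; omega
  obtain ⟨y, Py, xy, cxy, nxy, gy⟩ := step x Px xb
  have yb := Py.2.1
  have e : ∀ p q : ℕ, p < q → q < m → (p : ZMod m) ≠ (q : ZMod m) := by
    intro p q hpq hq
    rw [Ne, val_ext, val_cast hq, val_cast (by omega)]; omega
  have card3 : ({(a : ZMod m), (x : ZMod m), (b : ZMod m)} : Finset (ZMod m)).card = 3 := by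
    rw [Finset.card_insert_of_notMem, Finset.card_pair]
    · exact e _ _ xb hbm
    · simp only [Finset.mem_insert, Finset.mem_singleton, not_or]
      exact ⟨e _ _ ax (by omega), e _ _ (by omega) (by omega)⟩
  have hcell : IsCell m D C := by
    rw [cell_iff hm D h.1.1]
    constructor
    · rw [← card3]
      apply Finset.card_le_card
      intro z hz
      simp only [Finset.mem_insert, Finset.mem_singleton] at hz
      rcases hz with rfl | rfl | rfl
      · exact memc _ Pa
      · exact memc _ Px
      · exact memc _ Pb
    · intro p r hp hr hpr
      rw [mem] at hp hr
      constructor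
      · rintro (hc | hc)
        · obtain ⟨w, Pw, zw, czw, nzw, gw⟩ := step p.val hp (by have := hr.2.1; omega)
          have h1 := gw _ hr
          have h2 := hc _ (memc w Pw)
          rw [val_cast czw.2.1] at h2
          have : w = r.val := by omega
          rwa [← this]
        · have h1 := hc _ (memc a Pa)
          have h2 := hc _ (memc b Pb)
          rw [val_cast (by omega)] at h1 h2
          have := hp.1
          have := hr.2.1
          have e1 : p.val = a := by omega
          have e2 : r.val = b := by omega
          rwa [e1, e2]
      · intro hc
        by_cases e : p.val = a ∧ r.val = b
        · right
          intro z hz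
          rw [mem] at hz
          have := hz.1
          have := hz.2.1
          omega
        · left
          intro z hz
          rw [mem] at hz
          exact hz.2.2 _ _ hc hp.1 hr.2.1 e
  have hcard := h.2 C hcell
  have yb' : y < b := by
    by_contra hy
    have : y = b := by omega
    subst this
    have : C ⊆ {(a : ZMod m), (x : ZMod m), (y : ZMod m)} := by
      intro z hz
      rw [mem] at hz
      have h1 := gx _ hz
      have h2 := gy _ hz
      have h3 := hz.1
      have h4 := hz.2.1
      simp only [Finset.mem_insert, Finset.mem_singleton]
      simp only [val_ext]
      rw [val_cast hbm, val_cast (by omega : x < m), val_cast (by omega : a < m)]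
      omega
    have := Finset.card_le_card this
    omega
  obtain ⟨w, Pw, yw, cyw, nyw, gw⟩ := step y Py yb'
  have wb := Pw.2.1
  have : w = b := by
    by_contra hw
    have sub : insert (b : ZMod m) ({(a : ZMod m), (x : ZMod m), (y : ZMod m), (w : ZMod m)}) ⊆ C := by
      intro z hz
      simp only [Finset.mem_insert, Finset.mem_singleton] at hz
      rcases hz with rfl | rfl | rfl | rfl | rfl
      · exact memc _ Pb
      · exact memc _ Pa
      · exact memc _ Px
      · exact memc _ Py
      · exact memc _ Pw
    have := Finset.card_le_card sub
    rw [Finset.card_insert_of_notMem, quad_card ax xy yw (by omega)] at this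
    · omega
    · rw [mem_quad ax xy yw (by omega), val_cast hbm]
      omega
  subst this
  exact ⟨x, y, ax, xy, yb', cax, cxy, cyw⟩

theorem black_cast {m a : ℕ} (h : a < m) : IsBlack m (a : ZMod m) ↔ a % 2 = 1 := by
  unfold IsBlack; rw [val_cast h]

theorem odd_iff {m : ℕ} [NeZero m] (hm : 3 ≤ m) (D : Set (Sym2 (ZMod m)))
    (hD : ∀ e ∈ D, IsDiagonal m e) (h : QS m (ChD m D)) (e : Sym2 (ZMod m)) :
    e ∈ oddPairs m D ↔ ∃ u v, TQ (ChD m D) u v ∧ e = s((u : ZMod m), (v : ZMod m)) := by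
  constructor
  · rintro ⟨C, p, r, hC, he, hp, hr, hne, bp, br⟩
    obtain ⟨a, x, y, b, q, rfl⟩ := cell_quad hm D hD h C hC
    obtain ⟨h1, h2, h3, c0, c1, c2, c3⟩ := id q
    have hb := (h.lt _ _ c0).2
    have main : ∀ p r : ZMod m, e = s(p, r) → p ∈ ({(a : ZMod m), (x : ZMod m), (y : ZMod m),
        (b : ZMod m)} : Finset (ZMod m)) → r ∈ ({(a : ZMod m), (x : ZMod m), (y : ZMod m),
        (b : ZMod m)} : Finset (ZMod m)) → IsBlack m p → IsBlack m r → p.val < r.val →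
        ∃ u v, TQ (ChD m D) u v ∧ e = s((u : ZMod m), (v : ZMod m)) := by
      intro p r he hp hr bp br hpr
      rw [mem_quad h1 h2 h3 hb] at hp hr
      refine ⟨p.val, r.val, ⟨a, x, y, b, q, ?_⟩, by simp [he]⟩
      have p1 := h.par c1
      have p2 := h.par c2
      have p3 := h.par c3
      unfold IsBlack at bp br
      rcases hp with e | e | e | e <;> rcases hr with f | f | f | f <;> omega
    rw [Ne, val_ext] at hne
    rcases Nat.lt_or_gt_of_ne hne with i | i
    · exact main p r he hp hr bp br i
    · exact main r p (by rw [he]; exact Sym2.eq_swap) hr hp br bp i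
  · rintro ⟨u, v, ⟨a, x, y, b, q, hh⟩, rfl⟩
    have l := h.tree.lt u v ⟨a, x, y, b, q, hh⟩
    refine ⟨_, u, v, quad_cell hm D hD h q, rfl, ?_, ?_, ?_, ?_, ?_⟩
    · rcases hh with ⟨rfl, rfl, _⟩ | ⟨rfl, rfl, _⟩ <;> simp
    · rcases hh with ⟨rfl, rfl, _⟩ | ⟨rfl, rfl, _⟩ <;> simp
    · rw [Ne, val_ext, val_cast, val_cast] <;> omega
    · rw [black_cast] <;> omega
    · rw [black_cast] <;> omega

def TE (m : ℕ) (E : Set (Sym2 (ZMod m))) (u v : ℕ) : Prop :=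
  u < v ∧ v < m ∧ s((u : ZMod m), (v : ZMod m)) ∈ E

theorem te_val {m : ℕ} [NeZero m] (E : Set (Sym2 (ZMod m))) (a b : ZMod m) (h : a.val < b.val) :
    TE m E a.val b.val ↔ s(a, b) ∈ E := by
  have hb := ZMod.val_lt b
  simp [TE, h, hb]

theorem reach_inv {V : Type*} (G : SimpleGraph V) (S : V → Prop)
    (h : ∀ p q, G.Adj p q → S p → S q) {u v : V} (r : G.Reachable u v) : S u → S v := by
  obtain ⟨w⟩ := r
  induction w with
  | nil => exact id
  | cons hadj _ ih => exact fun hs => ih (h _ _ hadj hs)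

theorem nt_of_tree {m : ℕ} [NeZero m] (E : Set (Sym2 (ZMod m))) (h : IsNoncrossingTree m E) :
    NT m (TE m E) := by
  obtain ⟨h1, h2, h3, h4⟩ := h
  constructor
  · rintro u v ⟨k1, k2, k3⟩
    obtain ⟨a, b, hab, hne, ba, bb⟩ := h1 _ k3
    rw [Sym2.eq_iff] at hab
    rcases hab with ⟨rfl, rfl⟩ | ⟨rfl, rfl⟩ <;>
    · rw [black_cast (by omega)] at ba bb
      omega
  · rintro a b c d ⟨k1, k2, k3⟩ ⟨l1, l2, l3⟩ hh
    have := h2 _ k3 _ l3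
    rw [crosses_iff _ _ _ _ (by rw [val_cast, val_cast] <;> omega)
        (by rw [val_cast, val_cast] <;> omega)] at this
    rw [val_cast, val_cast, val_cast, val_cast] at this <;> omega
  · intro S hS u v hu hv ou ov su
    have r := h3 u v (by rwa [black_cast hu]) (by rwa [black_cast hv])
    have := reach_inv _ (fun z : ZMod m => S z.val) ?_ r (by simpa only [val_cast hu] using su)
    · simpa only [val_cast hv] using this
    · intro p q hpq sp
      rw [SimpleGraph.fromEdgeSet_adj] at hpq
      obtain ⟨e1, e2⟩ := hpq
      rw [Ne, val_ext] at e2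
      rcases Nat.lt_or_gt_of_ne e2 with i | i
      · exact (hS _ _ ((te_val E p q i).2 e1)).1 sp
      · exact (hS _ _ ((te_val E q p i).2 (by rwa [Sym2.eq_swap]))).2 sp
  · rintro p q ⟨k1, k2, k3⟩
    have vne : ∀ u v : ℕ, u < v → v < m → (u : ZMod m) ≠ (v : ZMod m) := by
      intro u v huv hv
      rw [Ne, val_ext, val_cast, val_cast] <;> omega
    have adj : (SimpleGraph.fromEdgeSet E).Adj (p : ZMod m) (q : ZMod m) := by
      rw [SimpleGraph.fromEdgeSet_adj]; exact ⟨k3, vne _ _ k1 k2⟩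
    have br := SimpleGraph.isAcyclic_iff_forall_adj_isBridge.1 h4 adj
    rw [SimpleGraph.isBridge_iff] at br
    refine ⟨fun n => ((SimpleGraph.fromEdgeSet E).deleteEdges {s((p : ZMod m), (q : ZMod m))}).Reachable
      (p : ZMod m) (n : ZMod m), SimpleGraph.Reachable.refl _, br, ?_⟩
    rintro u v ⟨l1, l2, l3⟩ hne
    have adj' : ((SimpleGraph.fromEdgeSet E).deleteEdges {s((p : ZMod m), (q : ZMod m))}).Adj
        (u : ZMod m) (v : ZMod m) := by
      rw [SimpleGraph.deleteEdges_adj, SimpleGraph.fromEdgeSet_adj]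
      refine ⟨⟨l3, vne _ _ l1 l2⟩, ?_⟩
      rw [Set.mem_singleton_iff, Sym2.eq_iff]
      simp only [val_ext]
      rw [val_cast, val_cast, val_cast, val_cast] <;> omega
    exact ⟨fun r => r.trans adj'.reachable, fun r => r.trans adj'.symm.reachable⟩

theorem tree_of_nt {m : ℕ} [NeZero m] (E : Set (Sym2 (ZMod m)))
    (hE : ∀ e ∈ E, ∃ a b, e = s(a, b) ∧ a ≠ b) (h : NT m (TE m E)) : IsNoncrossingTree m E := by
  refine ⟨?_, ?_, ?_, ?_⟩
  · intro e he
    obtain ⟨a, b, rfl, hab⟩ := diag_form (hE e he)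
    have := h.lt _ _ ((te_val E a b hab).2 he)
    exact ⟨a, b, rfl, by rw [Ne, val_ext]; omega, this.2.2.1, this.2.2.2⟩
  · intro e he f hf
    obtain ⟨a, b, rfl, hab⟩ := diag_form (hE e he)
    obtain ⟨c, d, rfl, hcd⟩ := diag_form (hE f hf)
    rw [crosses_iff _ _ _ _ hab hcd]
    have := h.nc2 ((te_val E a b hab).2 he) ((te_val E c d hcd).2 hf)
    omega
  · intro a b ba bb
    have := h.conn (fun n => (SimpleGraph.fromEdgeSet E).Reachable a (n : ZMod m)) ?_ a.val b.val
      (ZMod.val_lt a) (ZMod.val_lt b) ba bb (by simp)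
    · simpa using this
    · rintro u v ⟨l1, l2, l3⟩
      have adj' : (SimpleGraph.fromEdgeSet E).Adj (u : ZMod m) (v : ZMod m) := by
        rw [SimpleGraph.fromEdgeSet_adj]
        refine ⟨l3, ?_⟩
        rw [Ne, val_ext, val_cast, val_cast] <;> omega
      exact ⟨fun r => r.trans adj'.reachable, fun r => r.trans adj'.symm.reachable⟩
  · rw [SimpleGraph.isAcyclic_iff_forall_isBridge]
    intro e he
    rw [SimpleGraph.edgeSet_fromEdgeSet] at he
    obtain ⟨a, b, rfl, hab⟩ := diag_form (hE e he.1)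
    rw [SimpleGraph.isBridge_iff]
    intro r
    obtain ⟨S, s1, s2, hS⟩ := h.bridge _ _ ((te_val E a b hab).2 he.1)
    refine s2 (reach_inv _ (fun z : ZMod m => S z.val) ?_ r s1)
    intro p q hpq sp
    rw [SimpleGraph.deleteEdges_adj, SimpleGraph.fromEdgeSet_adj, Set.mem_singleton_iff] at hpq
    obtain ⟨⟨e1, e2⟩, e3⟩ := hpq
    rw [Sym2.eq_iff] at e3
    rw [Ne, val_ext] at e2
    simp only [val_ext] at e3
    rcases Nat.lt_or_gt_of_ne e2 with i | i
    · exact (hS _ _ ((te_val E p q i).2 e1) (by omega)).1 sp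
    · exact (hS _ _ ((te_val E q p i).2 (by rwa [Sym2.eq_swap])) (by omega)).2 sp

theorem chd_quad {m : ℕ} [NeZero m] (hm : 3 ≤ m) (hm2 : m % 2 = 0) (E : Set (Sym2 (ZMod m)))
    (hE : ∀ e ∈ E, ∃ a b, e = s(a, b) ∧ a ≠ b) :
    ChD m (quadOfTree m E) = ChT m (TE m E) := by
  funext a b
  apply propext
  constructor
  · rintro ⟨h1, h2, h3⟩
    refine ⟨h1, h2, ?_⟩
    have va : ((a : ZMod m)).val = a := val_cast (by omega)
    have vb : ((b : ZMod m)).val = b := val_cast (by omega)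
    rcases h3 with h3 | h3
    · obtain ⟨-, ⟨p, q, hpq, bp, bq⟩, hc⟩ := h3
      constructor
      · rw [Sym2.eq_iff] at hpq
        rcases hpq with ⟨rfl, rfl⟩ | ⟨rfl, rfl⟩ <;>
        · rw [black_cast (by omega)] at bp bq
          omega
      · rintro u v ⟨l1, l2, l3⟩
        have := hc _ l3
        rw [crosses_iff _ _ _ _ (by omega) (by rw [val_cast, val_cast] <;> omega), va, vb,
          val_cast l2, val_cast (by omega)] at this
        omega
    · refine ⟨by omega, ?_⟩
      rintro u v ⟨l1, l2, l3⟩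
      omega
  · rintro ⟨h1, h2, h3, h4⟩
    refine ⟨h1, h2, ?_⟩
    have va : ((a : ZMod m)).val = a := val_cast (by omega)
    have vb : ((b : ZMod m)).val = b := val_cast (by omega)
    by_cases hed : b = a + 1 ∨ (a = 0 ∧ b + 1 = m)
    · exact Or.inr hed
    left
    refine ⟨?_, ?_, ?_⟩
    · rw [diag_iff hm _ _ (by omega), va, vb]; exact hed
    · by_cases pa : a % 2 = 1
      · exact ⟨a, b, rfl, by rw [black_cast] <;> omega, by rw [black_cast] <;> omega⟩
      · exact ⟨b, a, Sym2.eq_swap, by rw [black_cast] <;> omega, by rw [black_cast] <;> omega⟩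
    · intro f hf
      obtain ⟨c, d, rfl, hcd⟩ := diag_form (hE f hf)
      rw [crosses_iff _ _ _ _ (by omega) hcd, va, vb]
      have := h4 _ _ ((te_val E c d hcd).2 hf)
      omega

theorem diag_ne {m : ℕ} {e : Sym2 (ZMod m)} (h : IsDiagonal m e) : ∃ a b, e = s(a, b) ∧ a ≠ b := by
  obtain ⟨a, b, h1, h2, _⟩ := h; exact ⟨a, b, h1, h2⟩

theorem chd_sub {m : ℕ} [NeZero m] (hm : 3 ≤ m) (D D' : Set (Sym2 (ZMod m)))
    (hD : ∀ e ∈ D, IsDiagonal m e) (h : ChD m D = ChD m D') :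
    D ⊆ D' := by
  intro e he
  have hd := hD e he
  obtain ⟨a, b, rfl, hab⟩ := diag_form (diag_ne hd)
  rw [diag_iff hm _ _ hab] at hd
  have := (chd_val D a b hab).2 (Or.inl he)
  rw [h, chd_val D' a b hab] at this
  tauto

theorem te_odd {m : ℕ} [NeZero m] (hm : 3 ≤ m) (D : Set (Sym2 (ZMod m)))
    (hD : ∀ e ∈ D, IsDiagonal m e) (h : QS m (ChD m D)) :
    TE m (oddPairs m D) = TQ (ChD m D) := by
  funext u v
  apply propext
  constructor
  · rintro ⟨h1, h2, h3⟩
    rw [odd_iff hm D hD h] at h3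
    obtain ⟨u', v', t, e⟩ := h3
    have l := h.tree.lt _ _ t
    rw [Sym2.eq_iff] at e
    simp only [val_ext] at e
    rw [val_cast h2, val_cast l.2.1, val_cast (by omega), val_cast (by omega)] at e
    have : u = u' ∧ v = v' := by omega
    rwa [this.1, this.2]
  · intro t
    have l := h.tree.lt _ _ t
    exact ⟨l.1, l.2.1, (odd_iff hm D hD h _).2 ⟨u, v, t, rfl⟩⟩

theorem odd_ne {m : ℕ} (D : Set (Sym2 (ZMod m))) :
    ∀ e ∈ oddPairs m D, ∃ a b, e = s(a, b) ∧ a ≠ b := by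
  rintro e ⟨C, a, b, _, he, _, _, hne, _⟩
  exact ⟨a, b, he, hne⟩

theorem quad_diag {m : ℕ} (E : Set (Sym2 (ZMod m))) :
    ∀ e ∈ quadOfTree m E, IsDiagonal m e := fun _ he => he.1

theorem tree_ne {m : ℕ} {E : Set (Sym2 (ZMod m))} (h : IsNoncrossingTree m E) :
    ∀ e ∈ E, ∃ a b, e = s(a, b) ∧ a ≠ b := by
  intro e he
  obtain ⟨a, b, h1, h2, _⟩ := h.1 e he
  exact ⟨a, b, h1, h2⟩

theorem main_gen {m : ℕ} [NeZero m] (hm : 3 ≤ m) (hm2 : m % 2 = 0) :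
    Set.BijOn (oddPairs m) {D | IsPAngulation m 4 D} {E | IsNoncrossingTree m E} ∧
    Set.InvOn (quadOfTree m) (oddPairs m) {D | IsPAngulation m 4 D}
      {E | IsNoncrossingTree m E} := by
  have m1 : Set.MapsTo (oddPairs m) {D | IsPAngulation m 4 D} {E | IsNoncrossingTree m E} := by
    intro D hD
    have q := qs_of_pang hm D hD
    refine tree_of_nt _ (odd_ne D) ?_
    rw [te_odd hm D hD.1.1 q]
    exact q.tree
  have m2 : Set.MapsTo (quadOfTree m) {E | IsNoncrossingTree m E} {D | IsPAngulation m 4 D} := by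
    intro E hE
    refine pang_of_qs hm _ (quad_diag E) ?_
    rw [chd_quad hm hm2 E (tree_ne hE)]
    exact (nt_of_tree E hE).qs hm2 (by omega)
  have inv : Set.InvOn (quadOfTree m) (oddPairs m) {D | IsPAngulation m 4 D}
      {E | IsNoncrossingTree m E} := by
    constructor
    · intro D hD
      have q := qs_of_pang hm D hD
      have e : ChD m (quadOfTree m (oddPairs m D)) = ChD m D := by
        rw [chd_quad hm hm2 _ (odd_ne D), te_odd hm D hD.1.1 q]
        funext c d
        exact propext (q.cht c d)
      exact Set.Subset.antisymm (chd_sub hm _ _ (quad_diag _) e)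
        (chd_sub hm _ _ hD.1.1 e.symm)
    · intro E hE
      have t := nt_of_tree E hE
      have q := qs_of_pang hm _ (m2 hE)
      ext e
      rw [odd_iff hm _ (quad_diag E) q, chd_quad hm hm2 E (tree_ne hE)]
      simp only [t.tq hm2 (by omega)]
      constructor
      · rintro ⟨u, v, ⟨_, _, h⟩, rfl⟩
        exact h
      · intro he
        obtain ⟨a, b, rfl, hab⟩ := diag_form (tree_ne hE e he)
        exact ⟨a.val, b.val, (te_val E a b hab).2 he, by simp⟩
  exact ⟨inv.bijOn m1 m2, inv⟩

/-- The map sending a quadrangulation `D` of the `(2s+2)`-gon to the collection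
of the unique black–black diagonals of its quadrilaterals is a bijection between
quadrangulations of the `(2s+2)`-gon and noncrossing trees on the `s+1` black
vertices; its inverse sends a noncrossing tree to the set of all black–white
diagonals that cross no edge of the tree. -/
theorem stmt3 (s : ℕ) (hs : 1 ≤ s) :
    Set.BijOn (oddPairs (2 * s + 2))
      {D : Set (Sym2 (ZMod (2 * s + 2))) | IsPAngulation (2 * s + 2) 4 D}
      {E : Set (Sym2 (ZMod (2 * s + 2))) | IsNoncrossingTree (2 * s + 2) E} ∧
    Set.InvOn (quadOfTree (2 * s + 2)) (oddPairs (2 * s + 2))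
      {D : Set (Sym2 (ZMod (2 * s + 2))) | IsPAngulation (2 * s + 2) 4 D}
      {E : Set (Sym2 (ZMod (2 * s + 2))) | IsNoncrossingTree (2 * s + 2) E} := by
  exact main_gen (by omega) (by omega)

end FriezeNote
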